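/- Every Sp-invariant linear form on the space N₃ of normal tensors of order 3 is a scalar multiple of the total contraction f₃; that is, if φ : N₃ → ℝ is a linear map such that φ(M·T) = φ(T) for every M ∈ Sp(2n,ℝ) and every T ∈ N₃, then there is a real number c with φ(T) = c · Σ_{i,j,k,l,m,p = 1}^{2n} Ω^{il} Ω^{jm} Ω^{kp} T(e_i, e_j, e_k, e_l, e_m, e_p) for all T ∈ N₃. -/

import Mathlib

/-- `V n = ℝ^{2n}`, realized with index set `Fin n ⊕ Fin n` (as in Mathlib's
`Matrix.J` and `Matrix.symplecticGroup`). -/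
abbrev V (n : ℕ) : Type := (Fin n ⊕ Fin n) → ℝ

/-- The space of 6-multilinear forms on `V n`. -/
abbrev M6 (n : ℕ) := MultilinearMap ℝ (fun _ : Fin 6 => V n) ℝ

/-- The inverse symplectic matrix `Ω = J⁻¹`. -/
noncomputable def Om (n : ℕ) : Matrix (Fin n ⊕ Fin n) (Fin n ⊕ Fin n) ℝ :=
  (Matrix.J (Fin n) ℝ)⁻¹

/-- The standard basis vector `e i` of `V n`. -/
def e (n : ℕ) (i : Fin n ⊕ Fin n) : V n := Pi.single i 1

/-- Membership in `N₃`, the space of normal tensors of order 3: (i) symmetry in the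
2nd and 3rd arguments, and symmetry in the last three arguments; (ii) vanishing of
the symmetrization over the last five arguments; (iii) the exchange symmetry
`T(x,z,y,u,v,w) − T(y,z,x,u,v,w) = T(x,u,y,z,v,w) − T(y,u,x,z,v,w)`. -/
def IsN3 (n : ℕ) (T : M6 n) : Prop :=
  (∀ x y z u v w : V n, T ![x, y, z, u, v, w] = T ![x, z, y, u, v, w]) ∧
  (∀ (x y z : V n) (u : Fin 3 → V n) (σ : Equiv.Perm (Fin 3)),
    T ![x, y, z, u (σ 0), u (σ 1), u (σ 2)] = T ![x, y, z, u 0, u 1, u 2]) ∧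
  (∀ (x : V n) (u : Fin 5 → V n),
    ∑ σ : Equiv.Perm (Fin 5),
      T ![x, u (σ 0), u (σ 1), u (σ 2), u (σ 3), u (σ 4)] = 0) ∧
  (∀ x y z u v w : V n,
    T ![x, z, y, u, v, w] - T ![y, z, x, u, v, w]
      = T ![x, u, y, z, v, w] - T ![y, u, x, z, v, w])

/-- The action of a matrix `M` on a 6-multilinear form :
`(M·T)(x₁,…,x₆) = T(M⁻¹x₁, …, M⁻¹x₆)`. -/
noncomputable def matAct (n : ℕ) (M : Matrix (Fin n ⊕ Fin n) (Fin n ⊕ Fin n) ℝ)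
    (T : M6 n) : M6 n :=
  T.compLinearMap fun _ => (M⁻¹).mulVecLin

section Tensors

variable {n : ℕ}

/-- A permutation of the last five of six slots. -/
def permLast (σ : Equiv.Perm (Fin 5)) : Equiv.Perm (Fin 6) :=
  Equiv.Perm.decomposeFin.symm (0, σ)

lemma vecCons_comp_permLast (x : V n) (u : Fin 5 → V n) (σ : Equiv.Perm (Fin 5)) :
    (fun i => (Matrix.vecCons x u : Fin 6 → V n) (permLast σ i)) = Matrix.vecCons x (u ∘ σ) := by
  funext i
  refine Fin.cases ?_ (fun j => ?_) i
  · simp [permLast]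
  · simp [permLast]

lemma vecCons_comp_perm (x : V n) (u : Fin 5 → V n) (σ : Equiv.Perm (Fin 5)) :
    (Matrix.vecCons x (u ∘ σ) : Fin 6 → V n)
      = ![x, u (σ 0), u (σ 1), u (σ 2), u (σ 3), u (σ 4)] := by
  funext i; fin_cases i <;> rfl

lemma eq_vec_six (v : Fin 6 → V n) : v = ![v 0, v 1, v 2, v 3, v 4, v 5] := by
  funext i; fin_cases i <;> rfl

lemma ext_vec_six {S T : M6 n}
    (h : ∀ x y z u v w, S ![x, y, z, u, v, w] = T ![x, y, z, u, v, w]) : S = T := by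
  refine MultilinearMap.ext fun v => ?_
  rw [eq_vec_six v]
  exact h _ _ _ _ _ _

/-- Permutation of the arguments, as a linear map. -/
def permArgs (σ : Equiv.Perm (Fin 6)) : M6 n →ₗ[ℝ] M6 n :=
  (MultilinearMap.domDomCongrLinearEquiv ℝ ℝ (V n) ℝ σ).toLinearMap

lemma permArgs_apply (σ : Equiv.Perm (Fin 6)) (T : M6 n) (v : Fin 6 → V n) :
    permArgs σ T v = T (fun i => v (σ i)) := rfl

/-- Symmetrization over the last five arguments. -/
noncomputable def symLast : M6 n →ₗ[ℝ] M6 n :=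
  (1 / 120 : ℝ) • ∑ σ : Equiv.Perm (Fin 5), permArgs (permLast σ)

lemma symLast_apply (T : M6 n) (x : V n) (u : Fin 5 → V n) :
    symLast T (Matrix.vecCons x u)
      = (1 / 120) * ∑ σ : Equiv.Perm (Fin 5), T (Matrix.vecCons x (u ∘ σ)) := by
  simp only [symLast, LinearMap.smul_apply, LinearMap.sum_apply, smul_apply, sum_apply,
    permArgs_apply, smul_eq_mul, vecCons_comp_permLast]

lemma symLast_perm (T : M6 n) (x : V n) (u : Fin 5 → V n) (τ : Equiv.Perm (Fin 5)) :
    symLast T (Matrix.vecCons x (u ∘ τ)) = symLast T (Matrix.vecCons x u) := by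
  rw [symLast_apply, symLast_apply]
  congr 1
  exact Fintype.sum_equiv (Equiv.mulLeft τ) _ _ fun σ => by simp [Function.comp_assoc]

/-- The tensor is symmetric in its last five arguments. -/
def IsSymmLast (T : M6 n) : Prop :=
  ∀ (x : V n) (u : Fin 5 → V n) (τ : Equiv.Perm (Fin 5)),
    T (Matrix.vecCons x (u ∘ τ)) = T (Matrix.vecCons x u)

lemma symLast_eq_self {T : M6 n} (h : IsSymmLast T) : symLast T = T := by
  refine MultilinearMap.ext fun v => ?_
  rw [← Matrix.cons_head_tail v, symLast_apply]
  simp only [h _ _ _]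
  simp [Fintype.card_perm, Nat.factorial]

lemma IsSymmLast.swap_one_two {T : M6 n} (h : IsSymmLast T) (x y z u v w : V n) :
    T ![x, y, z, u, v, w] = T ![x, z, y, u, v, w] := by
  rw [← h x ![y, z, u, v, w] (Equiv.swap 0 1),
    show ⇑(Equiv.swap (0 : Fin 5) 1) = ![1, 0, 2, 3, 4] by decide]
  refine congrArg T ?_; funext i; fin_cases i <;> simp

lemma IsSymmLast.swap_one_three {T : M6 n} (h : IsSymmLast T) (x y z u v w : V n) :
    T ![x, y, z, u, v, w] = T ![x, u, z, y, v, w] := by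
  rw [← h x ![y, z, u, v, w] (Equiv.swap 0 2),
    show ⇑(Equiv.swap (0 : Fin 5) 2) = ![2, 1, 0, 3, 4] by decide]
  refine congrArg T ?_; funext i; fin_cases i <;> simp

lemma IsSymmLast.swap_one_four {T : M6 n} (h : IsSymmLast T) (x y z u v w : V n) :
    T ![x, y, z, u, v, w] = T ![x, v, z, u, y, w] := by
  rw [← h x ![y, z, u, v, w] (Equiv.swap 0 3),
    show ⇑(Equiv.swap (0 : Fin 5) 3) = ![3, 1, 2, 0, 4] by decide]
  refine congrArg T ?_; funext i; fin_cases i <;> simp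

lemma IsSymmLast.swap_three_four {T : M6 n} (h : IsSymmLast T) (x y z u v w : V n) :
    T ![x, y, z, u, v, w] = T ![x, y, z, v, u, w] := by
  rw [← h x ![y, z, u, v, w] (Equiv.swap 2 3),
    show ⇑(Equiv.swap (2 : Fin 5) 3) = ![0, 1, 3, 2, 4] by decide]
  refine congrArg T ?_; funext i; fin_cases i <;> simp

lemma IsSymmLast.swap_four_five {T : M6 n} (h : IsSymmLast T) (x y z u v w : V n) :
    T ![x, y, z, u, v, w] = T ![x, y, z, u, w, v] := by
  rw [← h x ![y, z, u, v, w] (Equiv.swap 3 4),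
    show ⇑(Equiv.swap (3 : Fin 5) 4) = ![0, 1, 2, 4, 3] by decide]
  refine congrArg T ?_; funext i; fin_cases i <;> simp

/-- Invariance under adjacent transpositions suffices for symmetry in the last five arguments. -/
lemma isSymmLast_of_swaps {T : M6 n}
    (h₁ : ∀ x y z u v w, T ![x, y, z, u, v, w] = T ![x, z, y, u, v, w])
    (h₂ : ∀ x y z u v w, T ![x, y, z, u, v, w] = T ![x, y, u, z, v, w])
    (h₃ : ∀ x y z u v w, T ![x, y, z, u, v, w] = T ![x, y, z, v, u, w])
    (h₄ : ∀ x y z u v w, T ![x, y, z, u, v, w] = T ![x, y, z, u, w, v]) : IsSymmLast T := by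
  intro x u τ
  have hτ : τ ∈ Submonoid.closure
      (Set.range fun i : Fin 4 => Equiv.swap i.castSucc i.succ) := by
    rw [Equiv.Perm.mclosure_swap_castSucc_succ]; trivial
  induction hτ using Submonoid.closure_induction generalizing u with
  | one => rfl
  | mul σ τ _ _ hσ hτ =>
    rw [Equiv.Perm.coe_mul, ← Function.comp_assoc, hτ, hσ]
  | mem σ hσ =>
    obtain ⟨i, rfl⟩ := hσ
    have hu : (Matrix.vecCons x u : Fin 6 → V n) = ![x, u 0, u 1, u 2, u 3, u 4] := by
      funext i; fin_cases i <;> rfl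
    rw [vecCons_comp_perm, hu]
    fin_cases i
    · simpa [Equiv.swap_apply_def] using (h₁ x (u 0) (u 1) (u 2) (u 3) (u 4)).symm
    · simpa [Equiv.swap_apply_def] using (h₂ x (u 0) (u 1) (u 2) (u 3) (u 4)).symm
    · simpa [Equiv.swap_apply_def] using (h₃ x (u 0) (u 1) (u 2) (u 3) (u 4)).symm
    · simpa [Equiv.swap_apply_def] using (h₄ x (u 0) (u 1) (u 2) (u 3) (u 4)).symm

lemma isSymmLast_symLast (T : M6 n) : IsSymmLast (symLast T) := symLast_perm T

/-- Symmetry in the first three and in the last three arguments, by adjacent transpositions. -/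
structure IsSymmThreeThree (T : M6 n) : Prop where
  swap₀₁ : ∀ x y z u v w, T ![x, y, z, u, v, w] = T ![y, x, z, u, v, w]
  swap₁₂ : ∀ x y z u v w, T ![x, y, z, u, v, w] = T ![x, z, y, u, v, w]
  swap₃₄ : ∀ x y z u v w, T ![x, y, z, u, v, w] = T ![x, y, z, v, u, w]
  swap₄₅ : ∀ x y z u v w, T ![x, y, z, u, v, w] = T ![x, y, z, u, w, v]

lemma perm_three_of_swaps {α β : Type*} {f : α → α → α → β}
    (h₁ : ∀ u v w, f u v w = f v u w) (h₂ : ∀ u v w, f u v w = f u w v)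
    (u : Fin 3 → α) (σ : Equiv.Perm (Fin 3)) :
    f (u (σ 0)) (u (σ 1)) (u (σ 2)) = f (u 0) (u 1) (u 2) := by
  have h01 := σ.injective.ne (show (0 : Fin 3) ≠ 1 by decide)
  have h02 := σ.injective.ne (show (0 : Fin 3) ≠ 2 by decide)
  have h12 := σ.injective.ne (show (1 : Fin 3) ≠ 2 by decide)
  generalize σ 0 = a at *
  generalize σ 1 = b at *
  generalize σ 2 = c at *
  have h102 := h₁ (u 1) (u 0) (u 2)
  have h021 := h₂ (u 0) (u 2) (u 1)
  have h120 := h₂ (u 1) (u 2) (u 0)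
  have h201 := h₁ (u 2) (u 0) (u 1)
  have h210 := h₁ (u 2) (u 1) (u 0)
  clear h₁ h₂
  fin_cases a <;> fin_cases b <;> fin_cases c <;> simp_all

/-- The normal tensor attached to the jet of a symplectic connection in Darboux coordinates. -/
lemma IsSymmThreeThree.isN3_sub_symLast {T : M6 n} (h : IsSymmThreeThree T) :
    IsN3 n (T - symLast T) := by
  have hs := isSymmLast_symLast T
  refine ⟨fun x y z u v w => ?_, fun x y z u σ => ?_, fun x u => ?_, fun x y z u v w => ?_⟩
  · simp only [sub_apply]
    rw [h.swap₁₂, hs.swap_one_two]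
  · have key := perm_three_of_swaps (f := fun u v w => (T - symLast T) ![x, y, z, u, v, w])
      ?_ ?_ u σ
    · convert key using 1
    · intro u v w
      simp only [sub_apply]
      rw [h.swap₃₄, hs.swap_three_four]
    · intro u v w
      simp only [sub_apply]
      rw [h.swap₄₅, hs.swap_four_five]
  · simp only [← vecCons_comp_perm, sub_apply, Finset.sum_sub_distrib,
      symLast_perm]
    rw [symLast_apply]
    simp [Fintype.card_perm, Nat.factorial]
  · simp only [sub_apply]
    rw [h.swap₀₁ x z y u v w, h.swap₁₂ z x y u v w, h.swap₀₁ z y x u v w,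
      h.swap₁₂ y z x u v w, h.swap₀₁ y x z u v w, h.swap₁₂ x y z u v w,
      h.swap₀₁ x u y z v w, h.swap₁₂ u x y z v w, h.swap₀₁ u y x z v w,
      h.swap₁₂ y u x z v w, h.swap₀₁ y x u z v w, h.swap₁₂ x y u z v w]
    have e₁ := hs.swap_one_three x z y u v w
    have e₂ := hs.swap_one_three y z x u v w
    linarith

/-- The defect of symmetry of `T` in its first two arguments. -/
def defect (T : M6 n) : M6 n := T - permArgs (Equiv.swap 0 1) T

/-- The primitive of the closed two-form `defect T` along the Euler field, up to a factor. -/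
def primitive (T : M6 n) : M6 n :=
  defect T + permArgs (Equiv.swap 1 2) (defect T) + permArgs (Equiv.swap 1 3) (defect T)
    + permArgs (Equiv.swap 1 4) (defect T) + permArgs (Equiv.swap 1 5) (defect T)

lemma defect_apply (T : M6 n) (x y z u v w : V n) :
    defect T ![x, y, z, u, v, w] = T ![x, y, z, u, v, w] - T ![y, x, z, u, v, w] := by
  simp only [defect, sub_apply, permArgs_apply]
  congr 2; funext i; fin_cases i <;> rfl

lemma primitive_apply (T : M6 n) (x y z u v w : V n) :
    primitive T ![x, y, z, u, v, w]
      = defect T ![x, y, z, u, v, w] + defect T ![x, z, y, u, v, w]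
        + defect T ![x, u, z, y, v, w] + defect T ![x, v, z, u, y, w]
        + defect T ![x, w, z, u, v, y] := by
  have h₁ : ∀ σ : Equiv.Perm (Fin 6), permArgs σ (defect T) ![x, y, z, u, v, w]
      = defect T ![![x, y, z, u, v, w] (σ 0), ![x, y, z, u, v, w] (σ 1), ![x, y, z, u, v, w] (σ 2),
        ![x, y, z, u, v, w] (σ 3), ![x, y, z, u, v, w] (σ 4), ![x, y, z, u, v, w] (σ 5)] :=
    fun σ => by rw [permArgs_apply]; exact congrArg _ (eq_vec_six _)
  simp only [primitive, add_apply, h₁]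
  rfl

/-- Every normal tensor of order three comes from a tensor symmetric in its first three and in
its last three arguments. -/
lemma IsN3.exists_isSymmThreeThree {T : M6 n} (h : IsN3 n T) :
    ∃ a : M6 n, IsSymmThreeThree a ∧ T = a - symLast a := by
  obtain ⟨h₁, h₂, h₃, h₄⟩ := h
  have s34 : ∀ x y z u v w, T ![x, y, z, u, v, w] = T ![x, y, z, v, u, w] :=
    fun x y z u v w => (h₂ x y z ![u, v, w] (Equiv.swap 0 1)).symm
  have s45 : ∀ x y z u v w, T ![x, y, z, u, v, w] = T ![x, y, z, u, w, v] :=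
    fun x y z u v w => (h₂ x y z ![u, v, w] (Equiv.swap 1 2)).symm
  have d23 : ∀ x y z u v w,
      defect T ![x, y, z, u, v, w] = defect T ![x, y, u, z, v, w] := by
    intro x y z u v w
    have := h₄ x y z u v w
    rw [h₁ x z y, h₁ y z x, h₁ x u y, h₁ y u x] at this
    simpa only [defect_apply] using this
  have d34 : ∀ x y z u v w,
      defect T ![x, y, z, u, v, w] = defect T ![x, y, z, v, u, w] := by
    intro x y z u v w
    rw [defect_apply, defect_apply, s34, s34 y x]
  have d45 : ∀ x y z u v w,
      defect T ![x, y, z, u, v, w] = defect T ![x, y, z, u, w, v] := by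
    intro x y z u v w
    rw [defect_apply, defect_apply, s45, s45 y x]
  have anti : ∀ x y z u v w,
      defect T ![x, y, z, u, v, w] = - defect T ![y, x, z, u, v, w] := by
    intro x y z u v w
    rw [defect_apply, defect_apply]; ring
  have closed : ∀ x y z u v w, defect T ![x, y, z, u, v, w] + defect T ![y, z, x, u, v, w]
      + defect T ![z, x, y, u, v, w] = 0 := by
    intro x y z u v w
    simp only [defect_apply]
    rw [h₁ x y z, h₁ y x z, h₁ z y x]; ring
  have hp : IsSymmLast (primitive T) := by
    apply isSymmLast_of_swaps
    · intro x y z u v w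
      simp only [primitive_apply]
      rw [d23 x u z y v w, d34 x v z u y w, d23 x v z y u w, d34 x v y z u w,
        d45 x w z u v y, d34 x w z u y v, d23 x w z y u v, d34 x w y z u v, d45 x w y u z v]
      ring
    · intro x y z u v w
      simp only [primitive_apply]
      rw [d23 x y z u v w, d23 x z u y v w, d23 x u z y v w, d23 x v z u y w, d23 x w z u v y]
      ring
    · intro x y z u v w
      simp only [primitive_apply]
      rw [d34 x y z u v w, d34 x z y u v w, d34 x u z y v w, d34 x v z u y w, d34 x w z u v y]
      ring
    · intro x y z u v w
      simp only [primitive_apply]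
      rw [d45 x y z u v w, d45 x z y u v w, d45 x u z y v w, d45 x v z u y w, d45 x w z u v y]
      ring
  have hd : ∀ x y z u v w, primitive T ![x, y, z, u, v, w] - primitive T ![y, x, z, u, v, w]
      = 6 * defect T ![x, y, z, u, v, w] := by
    intro x y z u v w
    have c₁ := closed x y z u v w
    have c₂ := closed x y u z v w
    have c₃ := closed x y v z u w
    have c₄ := closed x y w z u v
    rw [anti z x] at c₁
    rw [anti u x] at c₂
    rw [anti v x] at c₃
    rw [anti w x] at c₄
    have r₂ := d23 x y z u v w
    have r₃ := d34 x y z u v w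
    have r₄ := d23 x y z v u w
    have r₅ := d45 x y z u v w
    have r₆ := d34 x y z u w v
    have r₇ := d23 x y z w u v
    have a₁ := anti y x z u v w
    have t : ∀ p q r, defect T ![p, v, z, u, q, r] = defect T ![p, v, q, z, u, r] := by
      intro p q r; rw [d34, d23]
    have t' : ∀ p q, defect T ![p, w, z, u, v, q] = defect T ![p, w, q, z, u, v] := by
      intro p q; rw [d45, d34, d23]
    simp only [primitive_apply]
    rw [t, t, t', t', d23 x u z, d23 y u z]
    linarith
  have hsym0 : symLast T = 0 := by
    refine MultilinearMap.ext fun v => ?_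
    rw [← Matrix.cons_head_tail v, symLast_apply]
    simp only [vecCons_comp_perm]
    rw [h₃]; simp
  refine ⟨T - (1 / 6 : ℝ) • primitive T, ⟨?_, ?_, ?_, ?_⟩, ?_⟩
  · intro x y z u v w
    simp only [sub_apply, smul_apply, smul_eq_mul]
    have := hd x y z u v w
    rw [defect_apply] at this
    linarith
  · intro x y z u v w
    simp only [sub_apply, smul_apply, smul_eq_mul]
    rw [h₁, hp.swap_one_two]
  · intro x y z u v w
    simp only [sub_apply, smul_apply, smul_eq_mul]
    rw [s34, hp.swap_three_four]
  · intro x y z u v w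
    simp only [sub_apply, smul_apply, smul_eq_mul]
    rw [s45, hp.swap_four_five]
  · rw [map_sub, map_smul, hsym0, symLast_eq_self hp]
    simp

/-- The tensor product of six linear forms. -/
noncomputable def tensorSix (p : Fin 6 → V n) : M6 n :=
  (MultilinearMap.mkPiAlgebra ℝ (Fin 6) ℝ).compLinearMap fun i => dotProductBilin ℝ ℝ (p i)

lemma tensorSix_apply (p v : Fin 6 → V n) : tensorSix p v = ∏ i, p i ⬝ᵥ v i := rfl

/-- The tensor product of the cubes of two linear forms. -/
noncomputable def cubes (p q : V n) : M6 n := tensorSix ![p, p, p, q, q, q]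

lemma cubes_apply (p q x y z u v w : V n) :
    cubes p q ![x, y, z, u, v, w]
      = (p ⬝ᵥ x) * (p ⬝ᵥ y) * (p ⬝ᵥ z) * ((q ⬝ᵥ u) * (q ⬝ᵥ v) * (q ⬝ᵥ w)) := by
  rw [cubes, tensorSix_apply, Fin.prod_univ_six]
  simp; ring

lemma isSymmThreeThree_cubes (p q : V n) : IsSymmThreeThree (cubes p q) := by
  constructor <;> intro x y z u v w <;> simp only [cubes_apply] <;> ring

lemma eq_sum_tensorSix (a : M6 n) :
    a = ∑ i : Fin 6 → Fin n ⊕ Fin n, a (fun k => e n (i k)) • tensorSix fun k => e n (i k) := by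
  refine Module.Basis.ext_multilinear (fun _ => Pi.basisFun ℝ (Fin n ⊕ Fin n)) fun j => ?_
  simp only [sum_apply, smul_apply, tensorSix_apply, e,
    Pi.basisFun_apply, smul_eq_mul]
  rw [Finset.sum_eq_single j]
  · simp
  · intro i _ hij
    obtain ⟨k, hk⟩ := Function.ne_iff.mp hij
    rw [Finset.prod_eq_zero (Finset.mem_univ k), mul_zero]
    simp [hk]
  · simp

/-- Symmetrization over the first three and over the last three arguments. -/
noncomputable def symThreeThree : M6 n →ₗ[ℝ] M6 n :=
  (1 / 36 : ℝ) • ((1 + permArgs (Equiv.swap 0 1) + permArgs (Equiv.swap 0 2)) ∘ₗ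
    (1 + permArgs (Equiv.swap 1 2)) ∘ₗ
    (1 + permArgs (Equiv.swap 3 4) + permArgs (Equiv.swap 3 5)) ∘ₗ
    (1 + permArgs (Equiv.swap 4 5)))

lemma permArgs_eq_self {T : M6 n} {σ : Equiv.Perm (Fin 6)}
    (h : ∀ x y z u v w, T ![x, y, z, u, v, w]
      = T fun i => (![x, y, z, u, v, w] : Fin 6 → V n) (σ i)) : permArgs σ T = T :=
  ext_vec_six fun x y z u v w => (h x y z u v w).symm

lemma IsSymmThreeThree.symThreeThree_eq_self {T : M6 n} (h : IsSymmThreeThree T) :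
    symThreeThree T = T := by
  have h01 : permArgs (Equiv.swap 0 1) T = T := permArgs_eq_self fun x y z u v w => by
    rw [h.swap₀₁,
      show ⇑(Equiv.swap (0 : Fin 6) 1) = ![1, 0, 2, 3, 4, 5] by decide]
    refine congrArg T ?_; funext i; fin_cases i <;> simp
  have h12 : permArgs (Equiv.swap 1 2) T = T := permArgs_eq_self fun x y z u v w => by
    rw [h.swap₁₂,
      show ⇑(Equiv.swap (1 : Fin 6) 2) = ![0, 2, 1, 3, 4, 5] by decide]
    refine congrArg T ?_; funext i; fin_cases i <;> simp
  have h02 : permArgs (Equiv.swap 0 2) T = T := permArgs_eq_self fun x y z u v w => by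
    rw [h.swap₀₁, h.swap₁₂, h.swap₀₁,
      show ⇑(Equiv.swap (0 : Fin 6) 2) = ![2, 1, 0, 3, 4, 5] by decide]
    refine congrArg T ?_; funext i; fin_cases i <;> simp
  have h34 : permArgs (Equiv.swap 3 4) T = T := permArgs_eq_self fun x y z u v w => by
    rw [h.swap₃₄,
      show ⇑(Equiv.swap (3 : Fin 6) 4) = ![0, 1, 2, 4, 3, 5] by decide]
    refine congrArg T ?_; funext i; fin_cases i <;> simp
  have h45 : permArgs (Equiv.swap 4 5) T = T := permArgs_eq_self fun x y z u v w => by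
    rw [h.swap₄₅,
      show ⇑(Equiv.swap (4 : Fin 6) 5) = ![0, 1, 2, 3, 5, 4] by decide]
    refine congrArg T ?_; funext i; fin_cases i <;> simp
  have h35 : permArgs (Equiv.swap 3 5) T = T := permArgs_eq_self fun x y z u v w => by
    rw [h.swap₃₄, h.swap₄₅, h.swap₃₄,
      show ⇑(Equiv.swap (3 : Fin 6) 5) = ![0, 1, 2, 5, 4, 3] by decide]
    refine congrArg T ?_; funext i; fin_cases i <;> simp
  simp only [symThreeThree, LinearMap.smul_apply, LinearMap.comp_apply, LinearMap.add_apply,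
    Module.End.one_apply, map_add, h01, h12, h02, h34, h45, h35]
  module

/-- The permanent of a three by three matrix, given by its entries. -/
def permanentThree (x : Fin 3 → Fin 3 → ℝ) : ℝ :=
  x 0 0 * x 1 1 * x 2 2 + x 0 0 * x 1 2 * x 2 1 + x 0 1 * x 1 0 * x 2 2
    + x 0 1 * x 1 2 * x 2 0 + x 0 2 * x 1 0 * x 2 1 + x 0 2 * x 1 1 * x 2 0

lemma symThreeThree_tensorSix_apply (p v : Fin 6 → V n) :
    symThreeThree (tensorSix p) v = (1 / 36) *
      (permanentThree (fun i j => p (Fin.castAdd 3 i) ⬝ᵥ v (Fin.castAdd 3 j)) *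
        permanentThree (fun i j => p (Fin.natAdd 3 i) ⬝ᵥ v (Fin.natAdd 3 j))) := by
  rw [eq_vec_six v, eq_vec_six p]
  generalize v 0 = v0, v 1 = v1, v 2 = v2, v 3 = v3, v 4 = v4, v 5 = v5
  generalize p 0 = p0, p 1 = p1, p 2 = p2, p 3 = p3, p 4 = p4, p 5 = p5
  simp only [symThreeThree, LinearMap.smul_apply, LinearMap.comp_apply, LinearMap.add_apply,
    Module.End.one_apply, map_add, add_apply, smul_apply,
    permArgs_apply, tensorSix_apply, Fin.prod_univ_six, smul_eq_mul]
  simp [Equiv.swap_apply_def]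
  simp [permanentThree]
  ring

/-- The four signed sums `p₀ ± p₁ ± p₂`. -/
noncomputable def signedSum (p : Fin 3 → V n) (k : Fin 4) : V n :=
  p 0 + (![1, 1, -1, -1] k : ℝ) • p 1 + (![1, -1, 1, -1] k : ℝ) • p 2

/-- The product of the signs occurring in `signedSum`. -/
def signProd : Fin 4 → ℝ := ![1, -1, -1, 1]

lemma permanentThree_eq_polarization (p v : Fin 3 → V n) :
    permanentThree (fun i j => p i ⬝ᵥ v j) = (1 / 4) * ∑ k, signProd k *
      ((signedSum p k ⬝ᵥ v 0) * (signedSum p k ⬝ᵥ v 1) * (signedSum p k ⬝ᵥ v 2)) := by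
  simp only [Fin.sum_univ_four, signedSum, signProd, add_dotProduct, smul_dotProduct]
  simp [permanentThree]
  ring

lemma symThreeThree_tensorSix (p : Fin 6 → V n) :
    symThreeThree (tensorSix p) = (1 / 576 : ℝ) • ∑ k, ∑ l, (signProd k * signProd l) •
      cubes (signedSum (fun i => p (Fin.castAdd 3 i)) k)
        (signedSum (fun i => p (Fin.natAdd 3 i)) l) := by
  refine ext_vec_six fun x y z u v w => ?_
  rw [symThreeThree_tensorSix_apply, permanentThree_eq_polarization,
    permanentThree_eq_polarization]
  simp only [smul_apply, sum_apply, cubes_apply, smul_eq_mul]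
  rw [mul_mul_mul_comm, Finset.sum_mul_sum, ← mul_assoc]
  congr 1
  · norm_num
  · refine Finset.sum_congr rfl fun k _ => Finset.sum_congr rfl fun l _ => ?_
    rw [mul_mul_mul_comm]
    rfl

/-- Tensors symmetric in their first and last three arguments are spanned by products of cubes. -/
lemma IsSymmThreeThree.mem_span_cubes {T : M6 n} (h : IsSymmThreeThree T) :
    T ∈ Submodule.span ℝ (Set.range fun p : V n × V n => cubes p.1 p.2) := by
  rw [← h.symThreeThree_eq_self, eq_sum_tensorSix T, map_sum]
  refine Submodule.sum_mem _ fun i _ => ?_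
  rw [map_smul, symThreeThree_tensorSix]
  refine Submodule.smul_mem _ _ (Submodule.smul_mem _ _ (Submodule.sum_mem _ fun k _ =>
    Submodule.sum_mem _ fun l _ => Submodule.smul_mem _ _ (Submodule.subset_span ⟨(_, _), rfl⟩)))

/-- The normal tensor attached to a product of cubes. -/
noncomputable def normalCubes (p q : V n) : M6 n := cubes p q - symLast (cubes p q)

lemma isN3_normalCubes (p q : V n) : IsN3 n (normalCubes p q) :=
  (isSymmThreeThree_cubes p q).isN3_sub_symLast

lemma IsN3.mem_span_normalCubes {T : M6 n} (h : IsN3 n T) :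
    T ∈ Submodule.span ℝ (Set.range fun p : V n × V n => normalCubes p.1 p.2) := by
  obtain ⟨a, ha, rfl⟩ := h.exists_isSymmThreeThree
  have := Submodule.mem_map_of_mem (f := LinearMap.id - symLast) ha.mem_span_cubes
  rw [Submodule.map_span, ← Set.range_comp] at this
  simpa only [Function.comp_def, LinearMap.sub_apply, LinearMap.id_apply, normalCubes] using this

lemma normalCubes_smul_left (t : ℝ) (p q : V n) :
    normalCubes (t • p) q = t ^ 3 • normalCubes p q := by
  have : cubes (t • p) q = t ^ 3 • cubes p q := ext_vec_six fun x y z u v w => by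
    simp only [smul_apply, cubes_apply, smul_dotProduct, smul_eq_mul]; ring
  rw [normalCubes, normalCubes, this, map_smul, smul_sub]

lemma normalCubes_smul_right (t : ℝ) (p q : V n) :
    normalCubes p (t • q) = t ^ 3 • normalCubes p q := by
  have : cubes p (t • q) = t ^ 3 • cubes p q := ext_vec_six fun x y z u v w => by
    simp only [smul_apply, cubes_apply, smul_dotProduct, smul_eq_mul]; ring
  rw [normalCubes, normalCubes, this, map_smul, smul_sub]

/-- Interpolation of the cubic polynomial `t ↦ normalCubes p (q + t • r)` at `t = ±1, ±2`. -/
lemma normalCubes_interpolation (p q r : V n) :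
    normalCubes p q
      = (2 / 3 : ℝ) • (normalCubes p (q + (1 : ℝ) • r) + normalCubes p (q + (-1 : ℝ) • r))
      + (-1 / 6 : ℝ) • (normalCubes p (q + (2 : ℝ) • r) + normalCubes p (q + (-2 : ℝ) • r)) := by
  have : cubes p q
      = (2 / 3 : ℝ) • (cubes p (q + (1 : ℝ) • r) + cubes p (q + (-1 : ℝ) • r))
      + (-1 / 6 : ℝ) • (cubes p (q + (2 : ℝ) • r) + cubes p (q + (-2 : ℝ) • r)) :=
    ext_vec_six fun x y z u v w => by
      simp only [smul_apply, add_apply, cubes_apply, smul_dotProduct, add_dotProduct, smul_eq_mul]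
      ring
  rw [normalCubes, this]
  simp only [normalCubes, map_add, map_smul]
  module

lemma isN3_zero : IsN3 n 0 := by
  refine ⟨?_, ?_, ?_, ?_⟩ <;> intros <;> simp

lemma IsN3.add {S T : M6 n} (hS : IsN3 n S) (hT : IsN3 n T) : IsN3 n (S + T) := by
  obtain ⟨h₁, h₂, h₃, h₄⟩ := hS
  obtain ⟨k₁, k₂, k₃, k₄⟩ := hT
  refine ⟨fun x y z u v w => ?_, fun x y z u σ => ?_, fun x u => ?_, fun x y z u v w => ?_⟩
  · rw [add_apply, add_apply, h₁, k₁]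
  · rw [add_apply, add_apply, h₂, k₂]
  · simp only [add_apply, Finset.sum_add_distrib, h₃, k₃, add_zero]
  · simp only [add_apply]
    linear_combination h₄ x y z u v w + k₄ x y z u v w

lemma IsN3.smul {T : M6 n} (c : ℝ) (hT : IsN3 n T) : IsN3 n (c • T) := by
  obtain ⟨k₁, k₂, k₃, k₄⟩ := hT
  refine ⟨fun x y z u v w => ?_, fun x y z u σ => ?_, fun x u => ?_, fun x y z u v w => ?_⟩
  · rw [smul_apply, smul_apply, k₁]
  · rw [smul_apply, smul_apply, k₂]
  · simp only [smul_apply, ← Finset.smul_sum, k₃, smul_zero]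
  · simp only [smul_apply, smul_eq_mul]
    linear_combination c * k₄ x y z u v w

/-- The total contraction `f₃`. -/
noncomputable def totalContraction (T : M6 n) : ℝ :=
  ∑ i, ∑ j, ∑ k, ∑ l, ∑ m, ∑ p, Om n i l * Om n j m * Om n k p *
    T ![e n i, e n j, e n k, e n l, e n m, e n p]

lemma totalContraction_add (S T : M6 n) :
    totalContraction (S + T) = totalContraction S + totalContraction T := by
  simp only [totalContraction, add_apply, mul_add, Finset.sum_add_distrib]

lemma totalContraction_smul (c : ℝ) (T : M6 n) :
    totalContraction (c • T) = c * totalContraction T := by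
  simp only [totalContraction, smul_apply, smul_eq_mul, Finset.mul_sum]
  simp only [mul_left_comm c]

lemma Om_eq_neg : Om n = -Matrix.J (Fin n) ℝ := Matrix.J_inv _ _

lemma Om_antisymm (i j : Fin n ⊕ Fin n) : Om n i j = -Om n j i := by
  have := congrFun (congrFun (Matrix.J_transpose (Fin n) ℝ) i) j
  rw [Om_eq_neg]
  simp only [Matrix.transpose_apply, Matrix.neg_apply] at this ⊢
  linarith

/-- The total contraction kills tensors symmetric in their last five arguments. -/
lemma IsSymmLast.totalContraction_eq_zero {T : M6 n} (h : IsSymmLast T) :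
    totalContraction T = 0 := by
  have key : totalContraction T = -totalContraction T := by
    conv_lhs => unfold totalContraction
    simp only [totalContraction, ← Finset.sum_neg_distrib]
    refine Finset.sum_congr rfl fun i _ => ?_
    calc _ = ∑ k, ∑ l, ∑ j, ∑ m, ∑ p, Om n i l * Om n j m * Om n k p *
          T ![e n i, e n j, e n k, e n l, e n m, e n p] := by
          rw [Finset.sum_comm]
          refine Finset.sum_congr rfl fun k _ => Finset.sum_comm
      _ = ∑ k, ∑ l, ∑ j, ∑ m, ∑ p, -(Om n i l * Om n j m * Om n k p *
          T ![e n i, e n j, e n k, e n l, e n m, e n p]) := by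
          refine Finset.sum_congr rfl fun k _ => Finset.sum_congr rfl fun l _ => ?_
          rw [Finset.sum_comm]
          refine Finset.sum_congr rfl fun m _ => Finset.sum_congr rfl fun j _ =>
            Finset.sum_congr rfl fun p _ => ?_
          rw [h.swap_one_four, Om_antisymm j m]
          ring
      _ = _ := by
          rw [Finset.sum_comm (s := (Finset.univ : Finset (Fin n ⊕ Fin n)))]
          symm
          rw [Finset.sum_comm]
          symm
          rw [Finset.sum_comm]
          refine Finset.sum_congr rfl fun k _ => Finset.sum_comm
  linarith

/-- The symplectic form on covectors. -/
noncomputable def symp (p q : V n) : ℝ := p ⬝ᵥ (Om n).mulVec q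

lemma totalContraction_normalCubes (p q : V n) :
    totalContraction (normalCubes p q) = symp p q ^ 3 := by
  have h : totalContraction (normalCubes p q) = totalContraction (cubes p q) := by
    rw [normalCubes, sub_eq_add_neg, ← neg_one_smul ℝ (symLast _), totalContraction_add,
      totalContraction_smul, (isSymmLast_symLast _).totalContraction_eq_zero]
    ring
  have hs : symp p q = ∑ i, ∑ l, p i * (Om n i l * q l) := by
    simp only [symp, dotProduct, Matrix.mulVec, Finset.mul_sum]
  rw [h, pow_three, hs]
  calc totalContraction (cubes p q)
      = ∑ i, ∑ j, ∑ k, ∑ l, ∑ m, ∑ r, p i * (Om n i l * q l) *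
          (p j * (Om n j m * q m) * (p k * (Om n k r * q r))) := by
        simp only [totalContraction, cubes_apply, e, dotProduct_single, mul_one]
        refine Finset.sum_congr rfl fun i _ => Finset.sum_congr rfl fun j _ =>
          Finset.sum_congr rfl fun k _ => Finset.sum_congr rfl fun l _ =>
          Finset.sum_congr rfl fun m _ => Finset.sum_congr rfl fun r _ => by ring
    _ = _ := by simp only [← Finset.mul_sum, ← Finset.sum_mul]

lemma symp_add_left (p p' q : V n) : symp (p + p') q = symp p q + symp p' q :=
  add_dotProduct _ _ _

lemma symp_smul_left (t : ℝ) (p q : V n) : symp (t • p) q = t * symp p q :=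
  smul_dotProduct _ _ _

lemma symp_add_right (p q q' : V n) : symp p (q + q') = symp p q + symp p q' := by
  rw [symp, Matrix.mulVec_add, dotProduct_add, symp, symp]

lemma symp_smul_right (t : ℝ) (p q : V n) : symp p (t • q) = t * symp p q := by
  rw [symp, Matrix.mulVec_smul, dotProduct_smul, symp, smul_eq_mul]

lemma symp_sub_left (p p' q : V n) : symp (p - p') q = symp p q - symp p' q :=
  sub_dotProduct _ _ _

lemma symp_antisymm (p q : V n) : symp p q = -symp q p := by
  have h : (Om n).transpose = -Om n := by
    ext i j
    exact Om_antisymm j i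
  rw [symp, symp, Matrix.dotProduct_mulVec, ← Matrix.mulVec_transpose, h, Matrix.neg_mulVec,
    neg_dotProduct, dotProduct_comm]

lemma symp_self (p : V n) : symp p p = 0 := by
  have := symp_antisymm p p
  linarith

lemma exists_symp_ne_zero {p : V n} (hp : p ≠ 0) : ∃ q, symp p q ≠ 0 := by
  refine ⟨(Matrix.J (Fin n) ℝ).mulVec p, ?_⟩
  rw [symp, Matrix.mulVec_mulVec, Om_eq_neg, Matrix.neg_mul, Matrix.J_squared, neg_neg,
    Matrix.one_mulVec]
  exact fun h => hp (dotProduct_self_eq_zero.mp h)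

/-- The symplectic transvection `v ↦ v + c ω(u, v) u`. -/
noncomputable def transvect (c : ℝ) (u v : V n) : V n := v + (c * symp u v) • u

/-- The matrix of `transvect c u`. -/
noncomputable def transvectMatrix (c : ℝ) (u : V n) :
    Matrix (Fin n ⊕ Fin n) (Fin n ⊕ Fin n) ℝ :=
  1 + c • Matrix.vecMulVec u (Matrix.vecMul u (Om n))

lemma transvectMatrix_mulVec (c : ℝ) (u v : V n) :
    (transvectMatrix c u).mulVec v = transvect c u v := by
  rw [transvectMatrix, transvect, Matrix.add_mulVec, Matrix.one_mulVec, Matrix.smul_mulVec,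
    Matrix.vecMulVec_mulVec, ← Matrix.dotProduct_mulVec, mul_smul, symp]
  simp

lemma symp_transvect (c : ℝ) (u p q : V n) :
    symp (transvect c u p) (transvect c u q) = symp p q := by
  simp only [transvect, symp_add_left, symp_add_right, symp_smul_left, symp_smul_right,
    symp_self, symp_antisymm p u]
  ring

lemma mem_symplecticGroup_of_symp {N : Matrix (Fin n ⊕ Fin n) (Fin n ⊕ Fin n) ℝ}
    (h : ∀ p q, symp (N.mulVec p) (N.mulVec q) = symp p q) :
    N ∈ Matrix.symplecticGroup (Fin n) ℝ := by
  rw [SymplecticGroup.mem_iff', ← neg_inj]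
  have key : N.transpose * Om n * N = Om n := by
    ext i j
    have := h (e n i) (e n j)
    rw [symp, Matrix.mulVec_mulVec, ← Matrix.vecMul_transpose, ← Matrix.dotProduct_mulVec,
      Matrix.mulVec_mulVec, ← Matrix.mul_assoc] at this
    simpa [symp, e] using this
  simpa [Om_eq_neg] using key

lemma transvectMatrix_mem (c : ℝ) (u : V n) :
    transvectMatrix c u ∈ Matrix.symplecticGroup (Fin n) ℝ :=
  mem_symplecticGroup_of_symp fun p q => by
    simp only [transvectMatrix_mulVec, symp_transvect]

lemma matAct_apply (M : Matrix (Fin n ⊕ Fin n) (Fin n ⊕ Fin n) ℝ) (T : M6 n)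
    (v : Fin 6 → V n) : matAct n M T v = T fun i => M⁻¹.mulVec (v i) := rfl

lemma matAct_symLast (M : Matrix (Fin n ⊕ Fin n) (Fin n ⊕ Fin n) ℝ) (T : M6 n) :
    matAct n M (symLast T) = symLast (matAct n M T) := by
  have hc : ∀ (x : V n) (u : Fin 5 → V n),
      (fun i => M⁻¹.mulVec ((Matrix.vecCons x u : Fin 6 → V n) i))
        = Matrix.vecCons (M⁻¹.mulVec x) fun i => M⁻¹.mulVec (u i) := by
    intro x u
    funext i
    refine Fin.cases ?_ (fun j => ?_) i <;> simp
  refine MultilinearMap.ext fun v => ?_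
  rw [← Matrix.cons_head_tail v, symLast_apply, matAct_apply, hc, symLast_apply]
  simp only [matAct_apply, hc]
  rfl

lemma matAct_cubes {M N : Matrix (Fin n ⊕ Fin n) (Fin n ⊕ Fin n) ℝ} (h : M⁻¹ = N.transpose)
    (p q : V n) : matAct n M (cubes p q) = cubes (N.mulVec p) (N.mulVec q) := by
  have hd : ∀ a x : V n, a ⬝ᵥ M⁻¹.mulVec x = N.mulVec a ⬝ᵥ x := by
    intro a x
    rw [h, Matrix.dotProduct_mulVec, Matrix.vecMul_transpose]
  refine MultilinearMap.ext fun v => ?_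
  rw [matAct_apply, eq_vec_six v, eq_vec_six fun i => _, cubes_apply, cubes_apply]
  simp only [hd]
  rfl

lemma matAct_normalCubes {M N : Matrix (Fin n ⊕ Fin n) (Fin n ⊕ Fin n) ℝ}
    (h : M⁻¹ = N.transpose) (p q : V n) :
    matAct n M (normalCubes p q) = normalCubes (N.mulVec p) (N.mulVec q) := by
  rw [normalCubes, normalCubes, ← matAct_cubes h, ← matAct_symLast]
  rfl

lemma exists_inv_eq_transpose {N : Matrix (Fin n ⊕ Fin n) (Fin n ⊕ Fin n) ℝ}
    (hN : N ∈ Matrix.symplecticGroup (Fin n) ℝ) :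
    ∃ M ∈ Matrix.symplecticGroup (Fin n) ℝ, M⁻¹ = N.transpose := by
  let g : Matrix.symplecticGroup (Fin n) ℝ := ⟨N.transpose, SymplecticGroup.transpose_mem hN⟩
  refine ⟨_, (g⁻¹).2, ?_⟩
  rw [SymplecticGroup.coe_inv', Matrix.nonsing_inv_nonsing_inv _
    (SymplecticGroup.symplectic_det g.2)]

/-- A function of two vectors that is invariant under all symplectic transvections. -/
def TransvectInvariant (F : V n → V n → ℝ) : Prop :=
  ∀ c u p q, F (transvect c u p) (transvect c u q) = F p q

lemma transvect_sub {a b : V n} (h : symp a b ≠ 0) :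
    transvect (-(symp a b)⁻¹) (b - a) a = b := by
  rw [transvect, symp_sub_left, symp_self, sub_zero, symp_antisymm b a, neg_mul_neg,
    inv_mul_cancel₀ h, one_smul, add_sub_cancel]

lemma transvect_eq_self {c : ℝ} {u a : V n} (h : symp u a = 0) : transvect c u a = a := by
  rw [transvect, h, mul_zero, zero_smul, add_zero]

lemma TransvectInvariant.congr_right_of_ne {F : V n → V n → ℝ} (hF : TransvectInvariant F)
    {a b b' : V n} (h : symp a b = symp a b') (hb : symp b b' ≠ 0) : F a b = F a b' := by
  have ha : symp (b' - b) a = 0 := by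
    rw [symp_sub_left, symp_antisymm b' a, symp_antisymm b a, h, sub_self]
  have := hF (-(symp b b')⁻¹) (b' - b) a b
  rw [transvect_sub hb, transvect_eq_self ha] at this
  exact this.symm

lemma TransvectInvariant.congr_right {F : V n → V n → ℝ} (hF : TransvectInvariant F)
    {a b b' : V n} (h : symp a b = symp a b') (h0 : symp a b ≠ 0) : F a b = F a b' := by
  by_cases hb : symp b b' = 0
  · have h₁ : symp a b = symp a (b + a) := by rw [symp_add_right, symp_self, add_zero]
    rw [hF.congr_right_of_ne h₁, hF.congr_right_of_ne (h₁.symm.trans h)]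
    · rwa [symp_add_left, hb, zero_add, ← h]
    · rw [symp_add_right, symp_self, zero_add, symp_antisymm]
      exact neg_ne_zero.mpr h0
  · exact hF.congr_right_of_ne h hb

lemma TransvectInvariant.congr_of_ne {F : V n → V n → ℝ} (hF : TransvectInvariant F)
    {a b a' b' : V n} (h : symp a b = symp a' b') (h0 : symp a b ≠ 0) (ha : symp a a' ≠ 0) :
    F a b = F a' b' := by
  have hs := symp_transvect (-(symp a a')⁻¹) (a' - a) a b
  rw [← hF (-(symp a a')⁻¹) (a' - a) a b]
  rw [transvect_sub ha] at hs ⊢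
  exact hF.congr_right (hs.trans h) (hs ▸ h0)

/-- Two pairs of vectors with the same nonzero symplectic product cannot be told apart by
invariant functions. -/
lemma TransvectInvariant.congr {F : V n → V n → ℝ} (hF : TransvectInvariant F)
    {a b a' b' : V n} (h : symp a b = symp a' b') (h0 : symp a b ≠ 0) : F a b = F a' b' := by
  obtain ⟨c, hc, hc'⟩ : ∃ c, symp a c ≠ 0 ∧ symp c a' ≠ 0 := by
    have h0' : symp b' a' ≠ 0 := by
      rw [symp_antisymm, ← h]
      exact neg_ne_zero.mpr h0
    by_cases h₁ : symp b a' = 0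
    · by_cases h₂ : symp a b' = 0
      · refine ⟨b + b', ?_, ?_⟩
        · rwa [symp_add_right, h₂, add_zero]
        · rwa [symp_add_left, h₁, zero_add]
      · exact ⟨b', h₂, h0'⟩
    · exact ⟨b, h0, h₁⟩
  obtain ⟨d, hd⟩ : ∃ d, symp c d = symp a b :=
    ⟨(symp a b * (symp c a')⁻¹) • a', by rw [symp_smul_right, inv_mul_cancel_right₀ hc']⟩
  rw [hF.congr_of_ne hd.symm h0 hc, hF.congr_of_ne (hd.trans h) (hd ▸ h0) hc']

end Tensors

/-- **Every `Sp(2n,ℝ)`-invariant linear form on `N₃` is a scalar multiple of the total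
contraction `f₃(T) = Σ Ω^{il} Ω^{jm} Ω^{kp} T(e_i,e_j,e_k,e_l,e_m,e_p)`.** -/
theorem invariant_linear_forms_on_N3 (n : ℕ) (hn : 1 ≤ n)
    (φ : M6 n → ℝ)
    (hadd : ∀ T S : M6 n, IsN3 n T → IsN3 n S → φ (T + S) = φ T + φ S)
    (hsmul : ∀ (c : ℝ) (T : M6 n), IsN3 n T → φ (c • T) = c * φ T)
    (hinv : ∀ M ∈ Matrix.symplecticGroup (Fin n) ℝ, ∀ T : M6 n, IsN3 n T →
      φ (matAct n M T) = φ T) :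
    ∃ c : ℝ, ∀ T : M6 n, IsN3 n T →
      φ T = c * ∑ i, ∑ j, ∑ k, ∑ l, ∑ m, ∑ p,
        Om n i l * Om n j m * Om n k p *
          T ![e n i, e n j, e n k, e n l, e n m, e n p] := by
  set F : V n → V n → ℝ := fun p q => φ (normalCubes p q) with hFdef
  have hF : TransvectInvariant F := by
    intro c u p q
    obtain ⟨M, hM, hMN⟩ := exists_inv_eq_transpose (transvectMatrix_mem c u)
    have := hinv M hM _ (isN3_normalCubes p q)
    rwa [matAct_normalCubes hMN, transvectMatrix_mulVec, transvectMatrix_mulVec] at this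
  have hl : ∀ t p q, F (t • p) q = t ^ 3 * F p q := fun t p q => by
    simp only [hFdef]
    rw [normalCubes_smul_left, hsmul _ _ (isN3_normalCubes p q)]
  have hr : ∀ t p q, F p (t • q) = t ^ 3 * F p q := fun t p q => by
    simp only [hFdef]
    rw [normalCubes_smul_right, hsmul _ _ (isN3_normalCubes p q)]
  obtain ⟨a, b, hab⟩ : ∃ a b : V n, symp a b = 1 := by
    have h1 : e n (Sum.inl ⟨0, hn⟩) ≠ 0 := fun h => by
      simpa [e] using congrFun h (Sum.inl ⟨0, hn⟩)
    obtain ⟨q, hq⟩ := exists_symp_ne_zero h1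
    exact ⟨_, (symp _ q)⁻¹ • q, by rw [symp_smul_right, inv_mul_cancel₀ hq]⟩
  have hne : ∀ p q, symp p q ≠ 0 → F p q = F a b * symp p q ^ 3 := by
    intro p q hpq
    have h : symp p q = symp a (symp p q • b) := by rw [symp_smul_right, hab, mul_one]
    rw [hF.congr h hpq, hr, mul_comm]
  have hall : ∀ p q, F p q = F a b * symp p q ^ 3 := by
    intro p q
    by_cases hpq : symp p q = 0
    · by_cases hp : p = 0
      · have h0 := hl 0 p q
        rw [zero_smul] at h0
        rw [hpq, hp, h0]
        ring
      · obtain ⟨r, hr0⟩ := exists_symp_ne_zero hp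
        have hv : ∀ t : ℝ, t ≠ 0 → F p (q + t • r) = F a b * (t * symp p r) ^ 3 := by
          intro t ht
          have hs : symp p (q + t • r) = t * symp p r := by
            rw [symp_add_right, symp_smul_right, hpq, zero_add]
          rw [hne _ _ (by rw [hs]; exact mul_ne_zero ht hr0), hs]
        have hN := fun t : ℝ => isN3_normalCubes p (q + t • r)
        have hint : F p q = (2 / 3) * (F p (q + (1 : ℝ) • r) + F p (q + (-1 : ℝ) • r))
            + (-1 / 6) * (F p (q + (2 : ℝ) • r) + F p (q + (-2 : ℝ) • r)) := by
          simp only [hFdef]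
          rw [normalCubes_interpolation p q r,
            hadd _ _ (((hN 1).add (hN (-1))).smul _) (((hN 2).add (hN (-2))).smul _),
            hsmul _ _ ((hN 1).add (hN (-1))), hsmul _ _ ((hN 2).add (hN (-2))),
            hadd _ _ (hN 1) (hN (-1)), hadd _ _ (hN 2) (hN (-2))]
        rw [hint, hv 1 (by norm_num), hv (-1) (by norm_num), hv 2 (by norm_num),
          hv (-2) (by norm_num), hpq]
        ring
    · exact hne p q hpq
  refine ⟨F a b, fun T hT => ?_⟩
  have key : IsN3 n T ∧ φ T = F a b * totalContraction T := by
    have hspan := hT.mem_span_normalCubes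
    clear hT
    induction hspan using Submodule.span_induction with
    | mem S hS =>
      obtain ⟨p, rfl⟩ := hS
      exact ⟨isN3_normalCubes _ _, by rw [totalContraction_normalCubes]; exact hall _ _⟩
    | zero =>
      have h0 := hsmul 0 0 isN3_zero
      have h0' := totalContraction_smul 0 (0 : M6 n)
      rw [zero_smul, zero_mul] at h0 h0'
      exact ⟨isN3_zero, by rw [h0, h0', mul_zero]⟩
    | add S S' _ _ hS hS' =>
      exact ⟨hS.1.add hS'.1, by
        rw [hadd _ _ hS.1 hS'.1, hS.2, hS'.2, totalContraction_add, mul_add]⟩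
    | smul t S _ hS =>
      exact ⟨hS.1.smul t, by
        rw [hsmul _ _ hS.1, hS.2, totalContraction_smul, mul_left_comm]⟩
  exact key.2
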